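/- Let X be a 3-Ucycle of [n]. If {a, b} and {a, c} are two distinct unordered pairs of elements of [n] that are both missing from X, then a contradiction arises; that is, no two unordered pairs missing from X share a common element of [n]. -/

import Mathlib

/-- A `t`-Ucycle of `[n]`: a cyclic sequence of length `k = C(n, t)` of elements of
`[n]` (modeled as `Fin n`) such that every `t`-element subset of `[n]` appears
exactly once among the `k` cyclic windows of length `t`. -/
def IsUcycle (n t : ℕ) (b : ZMod (n.choose t) → Fin n) : Prop :=
  ∀ s : Finset (Fin n), s.card = t →
    ∃! i : ZMod (n.choose t),
      (Multiset.range t).map (fun j => b (i + (j : ZMod (n.choose t)))) = s.val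

/-- No two unordered pairs missing from a 3-Ucycle share a common element. -/
theorem missing_pairs_disjoint (n : ℕ) (b : ZMod (n.choose 3) → Fin n)
    (h : IsUcycle n 3 b) (x y z : Fin n) (hxy : x ≠ y) (hxz : x ≠ z) (hyz : y ≠ z)
    (hmissy : ∀ i : ZMod (n.choose 3), ({b i, b (i + 1)} : Finset (Fin n)) ≠ {x, y})
    (hmissz : ∀ i : ZMod (n.choose 3), ({b i, b (i + 1)} : Finset (Fin n)) ≠ {x, z}) :
    False := by
  obtain ⟨i, hi, -⟩ := h {x, y, z} (by simp [hxy, hxz, hyz])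
  have hi' : ({b i, b (i + 1), b (i + 1 + 1)} : Multiset (Fin n)) = {x, y, z} := by
    have e : (({x, y, z} : Finset (Fin n)).val) = ({x, y, z} : Multiset (Fin n)) := by
      rw [Finset.insert_val_of_notMem (by simp [hxy, hxz]),
        Finset.insert_val_of_notMem (by simp [hyz])]
      rfl
    rw [← e, ← hi]
    have e2 : i + 1 + 1 = i + ((2 : ℕ) : ZMod (n.choose 3)) := by push_cast; ring
    have e3 : Multiset.range 3 = {0, 1, 2} := by decide
    rw [e2, e3]
    simp
  have key : ∀ w, w = x ∨ w = y ∨ w = z ↔ w = b i ∨ w = b (i + 1) ∨ w = b (i + 1 + 1) := by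
    intro w
    have := congrArg (fun m => w ∈ m) hi'
    simp at this
    exact this.symm
  have a1 := hmissy i
  have a2 := hmissy (i + 1)
  have a3 := hmissz i
  have a4 := hmissz (i + 1)
  have c1 := Finset.pair_comm x y
  have c2 := Finset.pair_comm x z
  have kx := key x
  have ky := key y
  have kz := key z
  generalize b i = p at *
  generalize b (i + 1) = q at *
  generalize b (i + 1 + 1) = r at *
  grind
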